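/- arXiv:1704.08228 — 2 statements merged into one kernel-verified Lean document; each statement's English description precedes it below -/
import Mathlib

section
/- Let α > 0, m > α, and let f be the unique density solution to the equation x^m f(x) = (1/Γ(α)) ∫_0^x (x−v)^{α−1} f(v) dv on (0,∞). Then x^{(α−m)/α} · log( ∫_0^{1/x} f(t) dt ) tends to −α/(m−α) as x → ∞. -/
open MeasureTheory Real Set Filter

noncomputable section

/-- `f` is a density solution to the integro-differential equation
`I^α_{0+} f = x^m f` on `(0,∞)`: `f` is measurable, nonnegative on `(0,∞)`,
integrates to `1` on `(0,∞)`, and satisfies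
`x^m f(x) = (1/Γ(α)) ∫_0^x (x−v)^{α−1} f(v) dv` for every `x > 0`. -/
def IsDensitySolution (α m : ℝ) (f : ℝ → ℝ) : Prop :=
  Measurable f ∧ (∀ x ∈ Set.Ioi (0:ℝ), 0 ≤ f x) ∧
  (∫ x in Set.Ioi (0:ℝ), f x) = 1 ∧
  ∀ x ∈ Set.Ioi (0:ℝ),
    x ^ m * f x = (1 / Real.Gamma α) * ∫ v in Set.Ioo (0:ℝ) x, (x - v) ^ (α - 1) * f v

open scoped ENNReal Topology

/-- The Riemann–Liouville kernel `t ^ (α - 1)` on `(0, ∞)`, extended by zero. -/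
def fracKernel (α t : ℝ) : ℝ≥0∞ :=
  (Ioi (0 : ℝ)).indicator (fun t => ENNReal.ofReal (t ^ (α - 1))) t

/-- The positive part of `f` restricted to `(0, ∞)`, extended by zero. -/
def halfLineDensity (f : ℝ → ℝ) (x : ℝ) : ℝ≥0∞ :=
  (Ioi (0 : ℝ)).indicator (fun x => ENNReal.ofReal (f x)) x

/-- The measure on `(0, ∞)` with density `f`. -/
def halfLineLaw (f : ℝ → ℝ) : Measure ℝ :=
  volume.withDensity (halfLineDensity f)

lemma measurable_fracKernel (α : ℝ) : Measurable (fracKernel α) := by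
  have : Measurable (fun t : ℝ => ENNReal.ofReal (t ^ (α - 1))) := by fun_prop
  exact this.indicator measurableSet_Ioi

lemma measurable_halfLineDensity {f : ℝ → ℝ} (hf : Measurable f) :
    Measurable (halfLineDensity f) :=
  hf.ennreal_ofReal.indicator measurableSet_Ioi

lemma lintegral_exp_mul_fracKernel {α r : ℝ} (hα : 0 < α) (hr : 0 < r) :
    ∫⁻ t, ENNReal.ofReal (exp (-(r * t))) * fracKernel α t =
      ENNReal.ofReal ((1 / r) ^ α * Gamma α) := by
  have h1 : ∀ t, ENNReal.ofReal (exp (-(r * t))) * fracKernel α t =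
      (Ioi (0 : ℝ)).indicator (fun t => ENNReal.ofReal (t ^ (α - 1) * exp (-(r * t)))) t := by
    intro t
    by_cases ht : t ∈ Ioi (0 : ℝ)
    · simp only [fracKernel, indicator_of_mem ht]
      rw [← ENNReal.ofReal_mul (exp_pos _).le, mul_comm]
    · simp [fracKernel, indicator_of_notMem ht]
  simp_rw [h1]
  rw [lintegral_indicator measurableSet_Ioi, ← integral_rpow_mul_exp_neg_mul_Ioi hα hr,
    ofReal_integral_eq_lintegral_ofReal]
  · have := integrableOn_rpow_mul_exp_neg_mul_rpow (p := 1) (s := α - 1) (b := r)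
      (by linarith) one_pos hr
    simpa [IntegrableOn] using this
  · filter_upwards [ae_restrict_mem measurableSet_Ioi] with t ht
    have : (0 : ℝ) < t := ht
    simp only [Pi.zero_apply]
    positivity

lemma lintegral_mul_lintegral_sub {h k φ : ℝ → ℝ≥0∞} (hh : Measurable h) (hk : Measurable k)
    (hφ : Measurable φ) :
    ∫⁻ x, h x * ∫⁻ v, k (x - v) * φ v = ∫⁻ v, φ v * ∫⁻ t, h (v + t) * k t := by
  calc ∫⁻ x, h x * ∫⁻ v, k (x - v) * φ v
      = ∫⁻ x, ∫⁻ v, h x * (k (x - v) * φ v) := by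
        refine lintegral_congr fun x => ?_
        rw [lintegral_const_mul]
        fun_prop
    _ = ∫⁻ v, ∫⁻ x, h x * (k (x - v) * φ v) := by
        apply lintegral_lintegral_swap
        unfold Function.uncurry
        fun_prop
    _ = ∫⁻ v, φ v * ∫⁻ t, h (v + t) * k t := by
        refine lintegral_congr fun v => ?_
        rw [← lintegral_const_mul _ (by fun_prop),
          ← lintegral_add_left_eq_self (fun x => h x * (k (x - v) * φ v)) v]
        refine lintegral_congr fun t => ?_
        rw [add_sub_cancel_left]
        ring

lemma lintegral_halfLineLaw {f : ℝ → ℝ} (hf : Measurable f) {g : ℝ → ℝ≥0∞} (hg : Measurable g) :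
    ∫⁻ x, g x ∂halfLineLaw f = ∫⁻ x, halfLineDensity f x * g x := by
  rw [halfLineLaw, lintegral_withDensity_eq_lintegral_mul _ (measurable_halfLineDensity hf) hg]
  rfl

lemma ae_pos_halfLineLaw {f : ℝ → ℝ} (hf : Measurable f) : ∀ᵐ x ∂halfLineLaw f, 0 < x := by
  rw [halfLineLaw, ae_withDensity_iff (measurable_halfLineDensity hf)]
  refine Eventually.of_forall fun x hx => ?_
  by_contra h
  exact hx (indicator_of_notMem (by simpa using h) _)

lemma halfLineLaw_apply {f : ℝ → ℝ} {s : Set ℝ} (hs : MeasurableSet s)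
    (h0 : s ⊆ Ioi 0) : halfLineLaw f s = ∫⁻ x in s, ENNReal.ofReal (f x) := by
  rw [halfLineLaw, withDensity_apply _ hs]
  refine setLIntegral_congr_fun hs fun x hx => ?_
  exact indicator_of_mem (h0 hx) _

namespace IsDensitySolution

variable {α m : ℝ} {f : ℝ → ℝ}

lemma integrableOn (hf : IsDensitySolution α m f) : IntegrableOn f (Ioi 0) := by
  by_contra h
  have := hf.2.2.1
  rw [integral_undef h] at this
  exact zero_ne_one this

lemma isProbabilityMeasure (hf : IsDensitySolution α m f) :
    IsProbabilityMeasure (halfLineLaw f) := by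
  refine ⟨?_⟩
  rw [halfLineLaw, withDensity_apply _ MeasurableSet.univ, Measure.restrict_univ]
  unfold halfLineDensity
  rw [lintegral_indicator measurableSet_Ioi, ← ofReal_integral_eq_lintegral_ofReal hf.integrableOn,
    hf.2.2.1, ENNReal.ofReal_one]
  filter_upwards [ae_restrict_mem measurableSet_Ioi] with t ht using hf.2.1 t ht

lemma setIntegral_eq (hf : IsDensitySolution α m f) (r : ℝ) :
    ∫ t in Ioo 0 r, f t = (halfLineLaw f).real (Ioo 0 r) := by
  rw [measureReal_def, halfLineLaw_apply measurableSet_Ioo Ioo_subset_Ioi_self,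
    integral_eq_lintegral_of_nonneg_ae _ hf.1.aestronglyMeasurable]
  filter_upwards [ae_restrict_mem measurableSet_Ioo] with t ht using hf.2.1 t ht.1

lemma ae_convolution_eq (hα : 0 < α) (hf : IsDensitySolution α m f) :
    ∀ᵐ x, ENNReal.ofReal (Gamma α) * (ENNReal.ofReal (x ^ m) * halfLineDensity f x) =
      ∫⁻ v, fracKernel α (x - v) * halfLineDensity f v := by
  have hφ := measurable_halfLineDensity hf.1
  have hk := measurable_fracKernel α
  have := hf.isProbabilityMeasure
  have hmeas : Measurable fun x : ℝ => ∫⁻ v, fracKernel α (x - v) * halfLineDensity f v := by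
    apply Measurable.lintegral_prod_right'
      (f := fun p : ℝ × ℝ => fracKernel α (p.1 - p.2) * halfLineDensity f p.2)
    fun_prop
  have hfin : ∀ᵐ x : ℝ, ENNReal.ofReal (exp (-(1 * x))) *
      ∫⁻ v, fracKernel α (x - v) * halfLineDensity f v < ∞ := by
    refine ae_lt_top (by fun_prop) ?_
    rw [lintegral_mul_lintegral_sub (by fun_prop) hk hφ]
    have h1 : ∀ v t : ℝ, ENNReal.ofReal (exp (-(1 * (v + t)))) * fracKernel α t =
        ENNReal.ofReal (exp (-v)) * (ENNReal.ofReal (exp (-(1 * t))) * fracKernel α t) := by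
      intro v t
      rw [← mul_assoc, ← ENNReal.ofReal_mul (exp_pos _).le, ← exp_add]
      ring_nf
    simp_rw [h1]
    have h2 : ∀ v : ℝ, ∫⁻ t, ENNReal.ofReal (exp (-v)) *
        (ENNReal.ofReal (exp (-(1 * t))) * fracKernel α t) =
        ENNReal.ofReal (exp (-v)) * ENNReal.ofReal ((1 / 1) ^ α * Gamma α) := by
      intro v
      rw [lintegral_const_mul _ (by fun_prop), lintegral_exp_mul_fracKernel hα one_pos]
    simp_rw [h2]
    have h3 : ∫⁻ v, halfLineDensity f v * (ENNReal.ofReal (exp (-v)) *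
        ENNReal.ofReal ((1 / 1) ^ α * Gamma α)) ≤
        ∫⁻ v, ENNReal.ofReal ((1 / 1) ^ α * Gamma α) ∂halfLineLaw f := by
      rw [lintegral_halfLineLaw hf.1 measurable_const]
      refine lintegral_mono fun v => ?_
      by_cases hv : v ∈ Ioi (0 : ℝ)
      · gcongr
        refine mul_le_of_le_one_left zero_le ?_
        rw [ENNReal.ofReal_le_one, exp_le_one_iff]
        have : (0 : ℝ) < v := hv
        linarith
      · simp [halfLineDensity, indicator_of_notMem hv]
    refine (h3.trans_lt ?_).ne
    simp
  filter_upwards [hfin] with x hx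
  have hx : ∫⁻ v, fracKernel α (x - v) * halfLineDensity f v < ∞ := by
    by_contra h
    rw [not_lt, top_le_iff] at h
    rw [h, ENNReal.mul_top (by simp [exp_pos])] at hx
    exact hx.ne rfl
  have hconv : ∫⁻ v, fracKernel α (x - v) * halfLineDensity f v =
      ∫⁻ v in Ioo 0 x, ENNReal.ofReal ((x - v) ^ (α - 1) * f v) := by
    rw [← lintegral_indicator measurableSet_Ioo]
    refine lintegral_congr fun v => ?_
    by_cases hv : v ∈ Ioo 0 x
    · have h1 : x - v ∈ Ioi (0 : ℝ) := by simpa using hv.2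
      have h2 : v ∈ Ioi (0 : ℝ) := hv.1
      rw [indicator_of_mem hv, fracKernel, halfLineDensity, indicator_of_mem h1,
        indicator_of_mem h2, ENNReal.ofReal_mul (rpow_nonneg (le_of_lt h1) _)]
    · rw [indicator_of_notMem hv]
      by_cases h2 : v ∈ Ioi (0 : ℝ)
      · have h1 : x - v ∉ Ioi (0 : ℝ) := by
          intro h1
          exact hv ⟨h2, by simpa using h1⟩
        simp [fracKernel, indicator_of_notMem h1]
      · simp [halfLineDensity, indicator_of_notMem h2]
  by_cases hx0 : x ∈ Ioi (0 : ℝ)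
  · have h := hf.2.2.2 x hx0
    have hΓ := Gamma_pos_of_pos hα
    rw [halfLineDensity, indicator_of_mem hx0,
      ← ENNReal.ofReal_mul (rpow_nonneg (le_of_lt hx0) _), h, ← ENNReal.ofReal_mul hΓ.le,
      ← mul_assoc, mul_one_div_cancel hΓ.ne', one_mul]
    rw [integral_eq_lintegral_of_nonneg_ae, ENNReal.ofReal_toReal, ← hconv]
    · rw [← hconv]; exact hx.ne
    · filter_upwards [ae_restrict_mem measurableSet_Ioo] with v hv
      exact mul_nonneg (rpow_nonneg (by linarith [hv.2]) _) (hf.2.1 v hv.1)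
    · have := hf.1
      exact Measurable.aestronglyMeasurable (by fun_prop)
  · rw [hconv, Ioo_eq_empty (by simpa using hx0)]
    simp [halfLineDensity, indicator_of_notMem hx0]

lemma Gamma_mul_lintegral (hα : 0 < α) (hf : IsDensitySolution α m f) {h : ℝ → ℝ≥0∞}
    (hh : Measurable h) :
    ENNReal.ofReal (Gamma α) * ∫⁻ x, ENNReal.ofReal (x ^ m) * h x ∂halfLineLaw f =
      ∫⁻ v, (∫⁻ t, h (v + t) * fracKernel α t) ∂halfLineLaw f := by
  have hφ := measurable_halfLineDensity hf.1
  have hk := measurable_fracKernel α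
  have hmeas : Measurable fun v : ℝ => ∫⁻ t, h (v + t) * fracKernel α t := by
    apply Measurable.lintegral_prod_right'
      (f := fun p : ℝ × ℝ => h (p.1 + p.2) * fracKernel α p.2)
    fun_prop
  rw [lintegral_halfLineLaw hf.1 hmeas, ← lintegral_mul_lintegral_sub hh hk hφ,
    lintegral_halfLineLaw hf.1 (by fun_prop), ← lintegral_const_mul _ (by fun_prop)]
  refine lintegral_congr_ae ?_
  filter_upwards [hf.ae_convolution_eq hα] with x hx
  rw [← hx]
  ring

lemma lintegral_rpow_mul_exp (hα : 0 < α) (hf : IsDensitySolution α m f) {r : ℝ} (hr : 0 < r) :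
    ∫⁻ x, ENNReal.ofReal (x ^ m * exp (-(r * x))) ∂halfLineLaw f =
      ENNReal.ofReal ((1 / r) ^ α) * ∫⁻ x, ENNReal.ofReal (exp (-(r * x))) ∂halfLineLaw f := by
  have hΓ := Gamma_pos_of_pos hα
  have hk := measurable_fracKernel α
  have key := hf.Gamma_mul_lintegral hα (h := fun x => ENNReal.ofReal (exp (-(r * x))))
    (by fun_prop)
  have h1 : ∀ v : ℝ, ∫⁻ t, ENNReal.ofReal (exp (-(r * (v + t)))) * fracKernel α t =
      ENNReal.ofReal ((1 / r) ^ α * Gamma α) * ENNReal.ofReal (exp (-(r * v))) := by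
    intro v
    rw [← lintegral_exp_mul_fracKernel hα hr, ← lintegral_mul_const _ (by fun_prop)]
    refine lintegral_congr fun t => ?_
    rw [mul_right_comm, ← ENNReal.ofReal_mul (exp_pos _).le, ← exp_add]
    ring_nf
  simp_rw [h1] at key
  rw [lintegral_const_mul _ (by fun_prop), mul_comm (_ ^ α), ENNReal.ofReal_mul hΓ.le,
    mul_assoc] at key
  rw [← (ENNReal.mul_right_inj (by simpa using hΓ) ENNReal.ofReal_ne_top).1 key]
  refine lintegral_congr_ae ?_
  filter_upwards [ae_pos_halfLineLaw hf.1] with x hx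
  rw [ENNReal.ofReal_mul (rpow_nonneg hx.le _)]

lemma lintegral_rpow_add_one_mul_exp (hα : 0 < α) (hf : IsDensitySolution α m f) {r : ℝ}
    (hr : 0 < r) :
    ∫⁻ x, ENNReal.ofReal (x ^ m * (x * exp (-(r * x)))) ∂halfLineLaw f =
      ENNReal.ofReal ((1 / r) ^ α) * ∫⁻ x, ENNReal.ofReal (x * exp (-(r * x))) ∂halfLineLaw f +
      ENNReal.ofReal (α * (1 / r) ^ (α + 1)) *
        ∫⁻ x, ENNReal.ofReal (exp (-(r * x))) ∂halfLineLaw f := by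
  have hΓ := Gamma_pos_of_pos hα
  have hk := measurable_fracKernel α
  have hk' := measurable_fracKernel (α + 1)
  have key := hf.Gamma_mul_lintegral hα (h := fun x => ENNReal.ofReal (x * exp (-(r * x))))
    (by fun_prop)
  have h1 : ∀ v : ℝ, 0 < v → ∫⁻ t, ENNReal.ofReal ((v + t) * exp (-(r * (v + t)))) *
      fracKernel α t =
      ENNReal.ofReal (Gamma α) * (ENNReal.ofReal ((1 / r) ^ α) *
        ENNReal.ofReal (v * exp (-(r * v))) +
      ENNReal.ofReal (α * (1 / r) ^ (α + 1)) * ENNReal.ofReal (exp (-(r * v)))) := by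
    intro v hv
    have e1 : ENNReal.ofReal (Gamma α) * (ENNReal.ofReal ((1 / r) ^ α) *
        ENNReal.ofReal (v * exp (-(r * v))) +
        ENNReal.ofReal (α * (1 / r) ^ (α + 1)) * ENNReal.ofReal (exp (-(r * v)))) =
        ENNReal.ofReal ((1 / r) ^ α * Gamma α) * ENNReal.ofReal (v * exp (-(r * v))) +
        ENNReal.ofReal ((1 / r) ^ (α + 1) * Gamma (α + 1)) * ENNReal.ofReal (exp (-(r * v))) := by
      rw [Gamma_add_one hα.ne', mul_comm (_ ^ α), ENNReal.ofReal_mul hΓ.le,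
        show (1 / r) ^ (α + 1) * (α * Gamma α) = Gamma α * (α * (1 / r) ^ (α + 1)) by ring,
        ENNReal.ofReal_mul (p := Gamma α) hΓ.le]
      ring
    rw [e1, ← lintegral_exp_mul_fracKernel hα hr,
      ← lintegral_exp_mul_fracKernel (by linarith : 0 < α + 1) hr,
      ← lintegral_mul_const _ (by fun_prop), ← lintegral_mul_const _ (by fun_prop),
      ← lintegral_add_left (by fun_prop)]
    refine lintegral_congr fun t => ?_
    by_cases ht : t ∈ Ioi (0 : ℝ)
    · have ht0 : 0 < t := ht
      simp only [fracKernel, indicator_of_mem ht]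
      rw [← ENNReal.ofReal_mul (by positivity), ← ENNReal.ofReal_mul (by positivity),
        ← ENNReal.ofReal_mul (by positivity), ← ENNReal.ofReal_mul (by positivity),
        ← ENNReal.ofReal_mul (by positivity), ← ENNReal.ofReal_add (by positivity) (by positivity)]
      congr 1
      rw [show α + 1 - 1 = α - 1 + 1 by ring, rpow_add_one ht0.ne',
        show -(r * (v + t)) = -(r * v) + -(r * t) by ring, exp_add]
      ring
    · simp [fracKernel, indicator_of_notMem ht]
  rw [lintegral_congr_ae (g := fun v => ENNReal.ofReal (Gamma α) * (ENNReal.ofReal ((1 / r) ^ α) *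
        ENNReal.ofReal (v * exp (-(r * v))) +
      ENNReal.ofReal (α * (1 / r) ^ (α + 1)) * ENNReal.ofReal (exp (-(r * v)))))
      ((ae_pos_halfLineLaw hf.1).mono h1),
    lintegral_const_mul _ (by fun_prop)] at key
  rw [← lintegral_const_mul _ (by fun_prop), ← lintegral_const_mul _ (by fun_prop),
    ← lintegral_add_left (by fun_prop),
    ← (ENNReal.mul_right_inj (by simpa using hΓ) ENNReal.ofReal_ne_top).1 key]
  refine lintegral_congr_ae ?_
  filter_upwards [ae_pos_halfLineLaw hf.1] with x hx
  rw [ENNReal.ofReal_mul (rpow_nonneg hx.le _)]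

end IsDensitySolution

section Asymptotics

lemma rpow_sub_one_mul_sub_one_nonneg {m w : ℝ} (hm : 0 < m) (hw : 0 < w) :
    0 ≤ (w ^ m - 1) * (w - 1) := by
  rcases le_total 1 w with h | h
  · exact mul_nonneg (sub_nonneg.2 (one_le_rpow h hm.le)) (sub_nonneg.2 h)
  · exact mul_nonneg_of_nonpos_of_nonpos (sub_nonpos.2 (rpow_le_one hw.le h hm.le))
      (sub_nonpos.2 h)

lemma exists_mul_abs_sub_one_le {m δ : ℝ} (hm : 0 < m) (hδ : 0 < δ) (hδ1 : δ < 1) :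
    ∃ κ > 0, ∀ w > 0, δ ≤ |w - 1| → κ * |w - 1| ≤ (w ^ m - 1) * (w - 1) := by
  have h1 : 1 < (1 + δ) ^ m := one_lt_rpow (by linarith) hm
  have h2 : (1 - δ) ^ m < 1 := rpow_lt_one (by linarith) (by linarith) hm
  refine ⟨min ((1 + δ) ^ m - 1) (1 - (1 - δ) ^ m), lt_min (by linarith) (by linarith),
    fun w hw h => ?_⟩
  rcases le_abs'.1 h with h | h
  · have h3 : w ^ m ≤ (1 - δ) ^ m := rpow_le_rpow hw.le (by linarith) hm.le
    rw [abs_of_nonpos (by linarith)]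
    nlinarith [min_le_right ((1 + δ) ^ m - 1) (1 - (1 - δ) ^ m)]
  · have h3 : (1 + δ) ^ m ≤ w ^ m := rpow_le_rpow (by linarith) (by linarith) hm.le
    rw [abs_of_nonneg (by linarith)]
    nlinarith [min_le_left ((1 + δ) ^ m - 1) (1 - (1 - δ) ^ m)]

lemma eventually_le_of_hasDerivAt_le_rpow {h h' : ℝ → ℝ} {q a a' : ℝ} (hq : 0 < q)
    (hd : ∀ r > 0, HasDerivAt h (h' r) r) (hle : ∀ᶠ r in atTop, h' r ≤ a * r ^ (q - 1))
    (haa : a < a') : ∀ᶠ r in atTop, h r ≤ a' / q * r ^ q := by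
  obtain ⟨R, hR⟩ := eventually_atTop.1 (hle.and (eventually_gt_atTop 0))
  have hR0 : 0 < R := (hR R le_rfl).2
  have hH : ∀ r > 0, HasDerivAt (fun r => h r - a / q * r ^ q) (h' r - a * r ^ (q - 1)) r := by
    intro r hr
    refine ((hd r hr).sub ((hasDerivAt_rpow_const (p := q) (Or.inl hr.ne')).const_mul
      (a / q))).congr_deriv ?_
    rw [← mul_assoc, div_mul_cancel₀ _ hq.ne']
  have hanti : AntitoneOn (fun r => h r - a / q * r ^ q) (Ici R) := by
    refine antitoneOn_of_deriv_nonpos (convex_Ici R) (fun r hr => ?_) (fun r hr => ?_)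
      (fun r hr => ?_)
    · exact (hH r (hR0.trans_le hr)).continuousAt.continuousWithinAt
    · rw [interior_Ici] at hr
      exact (hH r (hR0.trans hr)).differentiableAt.differentiableWithinAt
    · rw [interior_Ici] at hr
      rw [(hH r (hR0.trans hr)).deriv]
      linarith [(hR r (le_of_lt hr)).1]
  have hlim : Tendsto (fun r : ℝ => (a' - a) / q * r ^ q) atTop atTop :=
    (tendsto_rpow_atTop hq).const_mul_atTop (div_pos (sub_pos.2 haa) hq)
  filter_upwards [hlim.eventually_ge_atTop (h R - a / q * R ^ q), eventually_ge_atTop R]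
    with r h1 h2
  have h3 := hanti self_mem_Ici h2 h2
  simp only at h3
  have h4 : a' / q * r ^ q = (a' - a) / q * r ^ q + a / q * r ^ q := by ring
  linarith

/-- If `h' r / r ^ (q - 1)` tends to `a`, then `h r / r ^ q` tends to `a / q`. -/
lemma tendsto_div_rpow_of_hasDerivAt {h h' : ℝ → ℝ} {q a : ℝ} (hq : 0 < q)
    (hd : ∀ r > 0, HasDerivAt h (h' r) r)
    (hlim : Tendsto (fun r => h' r / r ^ (q - 1)) atTop (𝓝 a)) :
    Tendsto (fun r => h r / r ^ q) atTop (𝓝 (a / q)) := by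
  rw [tendsto_order]
  constructor
  · intro u hu
    rw [lt_div_iff₀ hq] at hu
    obtain ⟨c, hc1, hc2⟩ := exists_between hu
    obtain ⟨d, hd1, hd2⟩ := exists_between hc1
    have h1 : ∀ᶠ r in atTop, -h' r ≤ -c * r ^ (q - 1) := by
      filter_upwards [hlim.eventually_const_lt hc2, eventually_gt_atTop 0] with r hr hr0
      rw [lt_div_iff₀ (rpow_pos_of_pos hr0 _)] at hr
      linarith
    filter_upwards [eventually_le_of_hasDerivAt_le_rpow hq (fun r hr => (hd r hr).neg) h1
      (neg_lt_neg hd2), eventually_gt_atTop 0] with r hr hr0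
    have hr' : d / q * r ^ q ≤ h r := by
      simp only [Pi.neg_apply, neg_div, neg_mul] at hr
      linarith
    exact ((lt_div_iff₀ hq).2 hd1).trans_le ((le_div_iff₀ (rpow_pos_of_pos hr0 _)).2 hr')
  · intro u hu
    rw [gt_iff_lt, div_lt_iff₀ hq] at hu
    obtain ⟨c, hc1, hc2⟩ := exists_between hu
    obtain ⟨d, hd1, hd2⟩ := exists_between hc2
    have h1 : ∀ᶠ r in atTop, h' r ≤ c * r ^ (q - 1) := by
      filter_upwards [hlim.eventually_lt_const hc1, eventually_gt_atTop 0] with r hr hr0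
      rw [div_lt_iff₀ (rpow_pos_of_pos hr0 _)] at hr
      exact hr.le
    filter_upwards [eventually_le_of_hasDerivAt_le_rpow hq hd h1 hd1,
      eventually_gt_atTop 0] with r hr hr0
    exact ((div_le_iff₀ (rpow_pos_of_pos hr0 _)).2 hr).trans_lt ((div_lt_iff₀ hq).2 hd2)

end Asymptotics

/-- The Laplace transform of `halfLineLaw f`. -/
def laplace (f : ℝ → ℝ) (r : ℝ) : ℝ := ∫ x, exp (-(r * x)) ∂halfLineLaw f

/-- The first moment of the exponentially tilted `halfLineLaw f`. -/
def laplaceMoment (f : ℝ → ℝ) (r : ℝ) : ℝ := ∫ x, x * exp (-(r * x)) ∂halfLineLaw f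

namespace IsDensitySolution

variable {α m : ℝ} {f : ℝ → ℝ}

lemma integrable_exp (hf : IsDensitySolution α m f) {r : ℝ} (hr : 0 ≤ r) :
    Integrable (fun x => exp (-(r * x))) (halfLineLaw f) := by
  have := hf.isProbabilityMeasure
  refine Integrable.of_bound (C := 1) (Measurable.aestronglyMeasurable (by fun_prop)) ?_
  filter_upwards [ae_pos_halfLineLaw hf.1] with x hx
  rw [norm_of_nonneg (exp_pos _).le, exp_le_one_iff]
  nlinarith [mul_nonneg hr hx.le]

lemma integrable_mul_exp (hf : IsDensitySolution α m f) {r : ℝ} (hr : 0 < r) :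
    Integrable (fun x => x * exp (-(r * x))) (halfLineLaw f) := by
  have := hf.isProbabilityMeasure
  refine Integrable.of_bound (C := 1 / r) (Measurable.aestronglyMeasurable (by fun_prop)) ?_
  filter_upwards [ae_pos_halfLineLaw hf.1] with x hx
  rw [norm_of_nonneg (by positivity), le_div_iff₀ hr, exp_neg]
  have h1 : r * x ≤ exp (r * x) := by linarith [add_one_le_exp (r * x)]
  calc x * (exp (r * x))⁻¹ * r = r * x * (exp (r * x))⁻¹ := by ring
    _ ≤ exp (r * x) * (exp (r * x))⁻¹ := by gcongr
    _ = 1 := mul_inv_cancel₀ (exp_pos _).ne'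

lemma laplace_pos (hf : IsDensitySolution α m f) {r : ℝ} (hr : 0 ≤ r) : 0 < laplace f r := by
  have := hf.isProbabilityMeasure
  exact integral_exp_pos (hf.integrable_exp hr)

lemma hasDerivAt_laplace (hf : IsDensitySolution α m f) {r : ℝ} (hr : 0 < r) :
    HasDerivAt (laplace f) (-laplaceMoment f r) r := by
  have hsub : Iio (0 : ℝ) ⊆ ProbabilityTheory.integrableExpSet id (halfLineLaw f) := by
    intro t ht
    have := hf.integrable_exp (r := -t) (by linarith [mem_Iio.1 ht])
    simpa [ProbabilityTheory.integrableExpSet] using this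
  have hmem : -r ∈ interior (ProbabilityTheory.integrableExpSet id (halfLineLaw f)) :=
    interior_maximal hsub isOpen_Iio (by simpa using hr)
  have h := (ProbabilityTheory.hasDerivAt_mgf hmem).comp r (hasDerivAt_neg r)
  have e1 : laplace f = ProbabilityTheory.mgf id (halfLineLaw f) ∘ Neg.neg := by
    ext t
    simp [laplace, ProbabilityTheory.mgf]
  rw [e1]
  refine h.congr_deriv ?_
  simp [laplaceMoment]

lemma lintegral_exp (hf : IsDensitySolution α m f) {r : ℝ} (hr : 0 ≤ r) :
    ∫⁻ x, ENNReal.ofReal (exp (-(r * x))) ∂halfLineLaw f = ENNReal.ofReal (laplace f r) :=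
  (ofReal_integral_eq_lintegral_ofReal (hf.integrable_exp hr)
    (Eventually.of_forall fun _ => (exp_pos _).le)).symm

lemma lintegral_mul_exp (hf : IsDensitySolution α m f) {r : ℝ} (hr : 0 < r) :
    ∫⁻ x, ENNReal.ofReal (x * exp (-(r * x))) ∂halfLineLaw f =
      ENNReal.ofReal (laplaceMoment f r) :=
  (ofReal_integral_eq_lintegral_ofReal (hf.integrable_mul_exp hr)
    ((ae_pos_halfLineLaw hf.1).mono fun _ hx => by simp only [Pi.zero_apply]; positivity)).symm

lemma laplaceMoment_nonneg (hf : IsDensitySolution α m f) (r : ℝ) : 0 ≤ laplaceMoment f r :=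
  integral_nonneg_of_ae ((ae_pos_halfLineLaw hf.1).mono fun _ hx => by
    simp only [Pi.zero_apply]; positivity)

lemma hasMoment (hα : 0 < α) (hf : IsDensitySolution α m f) {r : ℝ} (hr : 0 < r) :
    Integrable (fun x => x ^ m * exp (-(r * x))) (halfLineLaw f) ∧
      ∫ x, x ^ m * exp (-(r * x)) ∂halfLineLaw f = (1 / r) ^ α * laplace f r := by
  have h0 : 0 ≤ᵐ[halfLineLaw f] fun x => x ^ m * exp (-(r * x)) :=
    (ae_pos_halfLineLaw hf.1).mono fun _ hx => by simp only [Pi.zero_apply]; positivity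
  have hmeas : AEStronglyMeasurable (fun x => x ^ m * exp (-(r * x))) (halfLineLaw f) :=
    Measurable.aestronglyMeasurable (by fun_prop)
  have hL := hf.laplace_pos hr.le
  have key := hf.lintegral_rpow_mul_exp hα hr
  rw [hf.lintegral_exp hr.le, ← ENNReal.ofReal_mul (by positivity)] at key
  refine ⟨⟨hmeas, ?_⟩, ?_⟩
  · rw [hasFiniteIntegral_iff_ofReal h0, key]
    exact ENNReal.ofReal_lt_top
  · rw [integral_eq_lintegral_of_nonneg_ae h0 hmeas, key, ENNReal.toReal_ofReal (by positivity)]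

lemma hasMoment_add_one (hα : 0 < α) (hf : IsDensitySolution α m f) {r : ℝ} (hr : 0 < r) :
    Integrable (fun x => x ^ m * (x * exp (-(r * x)))) (halfLineLaw f) ∧
      ∫ x, x ^ m * (x * exp (-(r * x))) ∂halfLineLaw f =
        (1 / r) ^ α * laplaceMoment f r + α * (1 / r) ^ (α + 1) * laplace f r := by
  have h0 : 0 ≤ᵐ[halfLineLaw f] fun x => x ^ m * (x * exp (-(r * x))) :=
    (ae_pos_halfLineLaw hf.1).mono fun _ hx => by simp only [Pi.zero_apply]; positivity
  have hmeas : AEStronglyMeasurable (fun x => x ^ m * (x * exp (-(r * x)))) (halfLineLaw f) :=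
    Measurable.aestronglyMeasurable (by fun_prop)
  have hL := hf.laplace_pos hr.le
  have hM := hf.laplaceMoment_nonneg r
  have key := hf.lintegral_rpow_add_one_mul_exp hα hr
  rw [hf.lintegral_exp hr.le, hf.lintegral_mul_exp hr, ← ENNReal.ofReal_mul (by positivity),
    ← ENNReal.ofReal_mul (by positivity),
    ← ENNReal.ofReal_add (by positivity) (by positivity)] at key
  refine ⟨⟨hmeas, ?_⟩, ?_⟩
  · rw [hasFiniteIntegral_iff_ofReal h0, key]
    exact ENNReal.ofReal_lt_top
  · rw [integral_eq_lintegral_of_nonneg_ae h0 hmeas, key, ENNReal.toReal_ofReal (by positivity)]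

/-- At the scale `r = y ^ (m / α)`, the tilted covariance of `(y x) ^ m` and `y x` is explicit. -/
lemma hasCovariance (hα : 0 < α) (hf : IsDensitySolution α m f) {y r : ℝ} (hy : 0 < y)
    (hr : r = y ^ (m / α)) :
    Integrable (fun x => ((y * x) ^ m - 1) * (y * x - 1) * exp (-(r * x))) (halfLineLaw f) ∧
      ∫ x, ((y * x) ^ m - 1) * (y * x - 1) * exp (-(r * x)) ∂halfLineLaw f =
        α * y / r * laplace f r := by
  have hr0 : 0 < r := hr ▸ rpow_pos_of_pos hy _
  obtain ⟨i1, e1⟩ := hf.hasMoment hα hr0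
  obtain ⟨i2, e2⟩ := hf.hasMoment_add_one hα hr0
  have i3 := hf.integrable_mul_exp hr0
  have i4 := hf.integrable_exp hr0.le
  have hrα : r ^ α = y ^ m := by rw [hr, ← rpow_mul hy.le, div_mul_cancel₀ _ hα.ne']
  have hy1 : y ^ m * (1 / r) ^ α = 1 := by
    rw [one_div, inv_rpow hr0.le, hrα, mul_inv_cancel₀ (rpow_pos_of_pos hy _).ne']
  have hy2 : y ^ m * (1 / r) ^ (α + 1) = 1 / r := by
    rw [rpow_add_one (by positivity), ← mul_assoc, hy1, one_mul]
  have hae : (fun x => ((y * x) ^ m - 1) * (y * x - 1) * exp (-(r * x))) =ᵐ[halfLineLaw f]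
      fun x => y ^ m * y * (x ^ m * (x * exp (-(r * x)))) - y ^ m * (x ^ m * exp (-(r * x))) -
        y * (x * exp (-(r * x))) + exp (-(r * x)) := by
    filter_upwards [ae_pos_halfLineLaw hf.1] with x hx
    rw [mul_rpow hy.le hx.le]
    ring
  have j2 := i2.const_mul (y ^ m * y)
  have j1 := i1.const_mul (y ^ m)
  have j3 := i3.const_mul y
  have j21 : Integrable (fun x => y ^ m * y * (x ^ m * (x * exp (-(r * x)))) -
    y ^ m * (x ^ m * exp (-(r * x)))) (halfLineLaw f) := j2.sub j1
  have j213 : Integrable (fun x => y ^ m * y * (x ^ m * (x * exp (-(r * x)))) -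
    y ^ m * (x ^ m * exp (-(r * x))) - y * (x * exp (-(r * x)))) (halfLineLaw f) := j21.sub j3
  refine ⟨(j213.add i4).congr hae.symm, ?_⟩
  rw [integral_congr_ae hae, integral_add j213 i4, integral_sub j21 j3, integral_sub j2 j1, integral_const_mul, integral_const_mul,
    integral_const_mul, e1, e2]
  change y ^ m * y * ((1 / r) ^ α * laplaceMoment f r + α * (1 / r) ^ (α + 1) * laplace f r) -
    y ^ m * ((1 / r) ^ α * laplace f r) - y * laplaceMoment f r + laplace f r = _
  linear_combination (y * laplaceMoment f r - laplace f r) * hy1 + y * α * laplace f r * hy2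

lemma abs_laplaceMoment_sub_le (hα : 0 < α) (hm : 0 < m) (hf : IsDensitySolution α m f)
    {δ : ℝ} (hδ : 0 < δ) (hδ1 : δ < 1) :
    ∃ C, ∀ y > 0, |y * (laplaceMoment f (y ^ (m / α)) / laplace f (y ^ (m / α))) - 1| ≤
      δ + C * (y / y ^ (m / α)) := by
  obtain ⟨κ, hκ, hκw⟩ := exists_mul_abs_sub_one_le hm hδ hδ1
  refine ⟨κ⁻¹ * α, fun y hy => ?_⟩
  set r := y ^ (m / α) with hr
  have hr0 : 0 < r := rpow_pos_of_pos hy _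
  obtain ⟨i1, e1⟩ := hf.hasCovariance hα hy hr
  have i3 := hf.integrable_mul_exp hr0
  have i4 := hf.integrable_exp hr0.le
  have hL := hf.laplace_pos hr0.le
  have h1 : y * laplaceMoment f r - laplace f r =
      ∫ x, (y * (x * exp (-(r * x))) - exp (-(r * x))) ∂halfLineLaw f := by
    rw [integral_sub (i3.const_mul y) i4, integral_const_mul]
    rfl
  have h2 : |y * laplaceMoment f r - laplace f r| ≤
      ∫ x, (δ * exp (-(r * x)) +
        κ⁻¹ * (((y * x) ^ m - 1) * (y * x - 1) * exp (-(r * x)))) ∂halfLineLaw f := by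
    rw [h1, ← norm_eq_abs]
    refine norm_integral_le_of_norm_le ((i4.const_mul δ).add (i1.const_mul κ⁻¹)) ?_
    filter_upwards [ae_pos_halfLineLaw hf.1] with x hx
    have hw : 0 < y * x := mul_pos hy hx
    have hn := rpow_sub_one_mul_sub_one_nonneg hm hw
    rw [show y * (x * exp (-(r * x))) - exp (-(r * x)) = (y * x - 1) * exp (-(r * x)) by ring,
      norm_mul, norm_eq_abs, norm_of_nonneg (exp_pos _).le, ← mul_assoc, ← add_mul]
    gcongr
    rcases le_or_gt δ |y * x - 1| with h | h
    · have := hκw _ hw h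
      have : |y * x - 1| ≤ κ⁻¹ * (((y * x) ^ m - 1) * (y * x - 1)) := by
        rwa [inv_mul_eq_div, le_div_iff₀ hκ, mul_comm]
      linarith
    · have : 0 ≤ κ⁻¹ * (((y * x) ^ m - 1) * (y * x - 1)) := by positivity
      linarith
  rw [integral_add (i4.const_mul δ) (i1.const_mul κ⁻¹), integral_const_mul, integral_const_mul,
    e1] at h2
  have h3 : y * (laplaceMoment f r / laplace f r) - 1 =
      (y * laplaceMoment f r - laplace f r) / laplace f r := by
    field_simp
  rw [h3, abs_div, abs_of_pos hL, div_le_iff₀ hL]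
  refine h2.trans_eq ?_
  change δ * laplace f r + _ = _
  ring

lemma tendsto_laplaceMoment_div (hα : 0 < α) (hm : α < m) (hf : IsDensitySolution α m f) :
    Tendsto (fun y => y * (laplaceMoment f (y ^ (m / α)) / laplace f (y ^ (m / α)))) atTop
      (𝓝 1) := by
  have hdecay : Tendsto (fun y : ℝ => y / y ^ (m / α)) atTop (𝓝 0) := by
    have h := tendsto_rpow_neg_atTop (sub_pos.2 ((one_lt_div hα).2 hm))
    refine h.congr' ?_
    filter_upwards [eventually_gt_atTop 0] with y hy
    rw [neg_sub, rpow_sub hy, rpow_one]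
  rw [Metric.tendsto_nhds]
  intro ε hε
  have hδ : 0 < min (ε / 2) (1 / 2) := by positivity
  obtain ⟨C, hC⟩ := hf.abs_laplaceMoment_sub_le hα (hα.trans hm) hδ
    ((min_le_right _ _).trans_lt (by norm_num))
  have h1 := (hdecay.const_mul C).eventually_lt_const (show C * 0 < ε / 2 by simpa using hε)
  filter_upwards [h1, eventually_gt_atTop 0] with y h2 hy
  rw [dist_eq]
  linarith [hC y hy, min_le_left (ε / 2) (1 / 2)]

lemma tendsto_log_laplace (hα : 0 < α) (hm : α < m) (hf : IsDensitySolution α m f) :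
    Tendsto (fun r => log (laplace f r) / r ^ (1 - α / m)) atTop (𝓝 (-1 / (1 - α / m))) := by
  have hm0 : 0 < m := hα.trans hm
  have hq : 0 < 1 - α / m := sub_pos.2 ((div_lt_one hm0).2 hm)
  refine tendsto_div_rpow_of_hasDerivAt hq
    (fun r hr => (hf.hasDerivAt_laplace hr).log (hf.laplace_pos hr.le).ne') ?_
  have h := ((hf.tendsto_laplaceMoment_div hα hm).comp
    (tendsto_rpow_atTop (div_pos hα hm0))).neg
  refine h.congr' ?_
  filter_upwards [eventually_gt_atTop 0] with r hr
  have e1 : (r ^ (α / m)) ^ (m / α) = r := by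
    rw [← rpow_mul hr.le, div_mul_div_cancel₀ hm0.ne', div_self hα.ne', rpow_one]
  simp only [Function.comp_apply]
  rw [e1, sub_sub_cancel_left, rpow_neg hr.le]
  field_simp

lemma measureReal_Ioo_le (hf : IsDensitySolution α m f) {r ε : ℝ} (hr : 0 ≤ r) :
    (halfLineLaw f).real (Ioo 0 ε) ≤ exp (r * ε) * laplace f r := by
  have := hf.isProbabilityMeasure
  rw [laplace, ← integral_const_mul, ← integral_indicator_one measurableSet_Ioo]
  refine integral_mono_ae ((integrable_const 1).indicator measurableSet_Ioo)
    ((hf.integrable_exp hr).const_mul _) (Eventually.of_forall fun x => ?_)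
  by_cases hx : x ∈ Ioo 0 ε
  · simp only [indicator_of_mem hx, Pi.one_apply]
    rw [← exp_add, one_le_exp_iff]
    nlinarith [hx.2]
  · simp only [indicator_of_notMem hx]
    positivity

lemma le_measureReal_Ioo (hα : 0 < α) (hm : 0 < m) (hf : IsDensitySolution α m f)
    {δ : ℝ} (hδ : 0 < δ) (hδ1 : δ < 1) :
    ∃ C, ∀ y > 0, exp (y ^ (m / α) / y * (1 - δ)) *
      (laplace f (y ^ (m / α)) * (1 - C * (y / y ^ (m / α)))) ≤
        (halfLineLaw f).real (Ioo 0 ((1 + δ) / y)) := by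
  obtain ⟨κ, hκ, hκw⟩ := exists_mul_abs_sub_one_le hm hδ hδ1
  refine ⟨(κ * δ)⁻¹ * α, fun y hy => ?_⟩
  have := hf.isProbabilityMeasure
  set r := y ^ (m / α) with hr
  have hr0 : 0 < r := rpow_pos_of_pos hy _
  obtain ⟨i1, e1⟩ := hf.hasCovariance hα hy hr
  have i4 := hf.integrable_exp hr0.le
  have h1 : exp (r / y * (1 - δ)) * (laplace f r * (1 - (κ * δ)⁻¹ * α * (y / r))) =
      ∫ x, exp (r / y * (1 - δ)) * (exp (-(r * x)) -
        (κ * δ)⁻¹ * (((y * x) ^ m - 1) * (y * x - 1) * exp (-(r * x)))) ∂halfLineLaw f := by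
    rw [integral_const_mul, integral_sub i4 (i1.const_mul _), integral_const_mul, e1]
    change _ = exp (r / y * (1 - δ)) * (laplace f r - _)
    ring
  rw [h1, ← integral_indicator_one measurableSet_Ioo]
  refine integral_mono_ae ((i4.sub (i1.const_mul _)).const_mul _)
    ((integrable_const 1).indicator measurableSet_Ioo) ?_
  filter_upwards [ae_pos_halfLineLaw hf.1] with x hx
  have hw : 0 < y * x := mul_pos hy hx
  have hn := rpow_sub_one_mul_sub_one_nonneg hm hw
  rcases le_or_gt δ |y * x - 1| with h | h
  · have h2 : κ * δ ≤ ((y * x) ^ m - 1) * (y * x - 1) :=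
      (mul_le_mul_of_nonneg_left h hκ.le).trans (hκw _ hw h)
    have h3 : 1 ≤ (κ * δ)⁻¹ * (((y * x) ^ m - 1) * (y * x - 1)) := by
      rwa [inv_mul_eq_div, one_le_div (by positivity)]
    refine le_trans ?_ (indicator_nonneg (fun _ _ => zero_le_one) x)
    refine mul_nonpos_of_nonneg_of_nonpos (exp_pos _).le ?_
    rw [← mul_assoc]
    nlinarith [exp_pos (-(r * x))]
  · rw [abs_lt] at h
    have hmem : x ∈ Ioo 0 ((1 + δ) / y) := ⟨hx, by rw [lt_div_iff₀ hy]; linarith⟩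
    simp only [indicator_of_mem hmem, Pi.one_apply]
    have h2 : 0 ≤ (κ * δ)⁻¹ * (((y * x) ^ m - 1) * (y * x - 1) * exp (-(r * x))) := by positivity
    calc exp (r / y * (1 - δ)) * (exp (-(r * x)) -
          (κ * δ)⁻¹ * (((y * x) ^ m - 1) * (y * x - 1) * exp (-(r * x))))
        ≤ exp (r / y * (1 - δ)) * exp (-(r * x)) := by
          gcongr
          linarith
      _ ≤ 1 := by
          rw [← exp_add, exp_le_one_iff]
          have : r / y * (1 - δ) ≤ r / y * (y * x) := by
            gcongr
            linarith
          have e : r / y * (y * x) = r * x := by field_simp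
          linarith

end IsDensitySolution

/-- Small-ball estimate: `x^{(α−m)/α} log ∫_0^{1/x} f → −α/(m−α)` as `x → ∞`. -/
theorem density_solution_small_ball (α m : ℝ) (hα : 0 < α) (hm : α < m)
    (f : ℝ → ℝ) (hf : IsDensitySolution α m f) :
    Filter.Tendsto
      (fun x : ℝ => x ^ ((α - m) / α) * Real.log (∫ t in Set.Ioo (0:ℝ) (1 / x), f t))
      Filter.atTop (nhds (-(α / (m - α)))) := by
  have hm0 : 0 < m := hα.trans hm
  set β := (m - α) / α with hβ
  have hβ0 : 0 < β := div_pos (sub_pos.2 hm) hα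
  set ℓ : ℝ → ℝ := fun y => log (laplace f (y ^ (m / α))) / y ^ β with hℓ
  have hpβ : ∀ y : ℝ, 0 < y → y ^ (m / α) / y = y ^ β := by
    intro y hy
    rw [hβ, sub_div, div_self hα.ne', rpow_sub_one hy.ne']
  have hℓlim : Tendsto ℓ atTop (𝓝 (-(m / (m - α)))) := by
    have h := (hf.tendsto_log_laplace hα hm).comp (tendsto_rpow_atTop (div_pos hm0 hα))
    have hma : m - α ≠ 0 := (sub_pos.2 hm).ne'
    rw [show -1 / (1 - α / m) = -(m / (m - α)) by field_simp] at h
    refine h.congr' ?_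
    filter_upwards [eventually_gt_atTop 0] with y hy
    simp only [Function.comp_apply, hℓ]
    rw [← rpow_mul hy.le, show m / α * (1 - α / m) = β by rw [hβ]; field_simp]
  have hlogℓ : ∀ y : ℝ, 0 < y → log (laplace f (y ^ (m / α))) = y ^ β * ℓ y := by
    intro y hy
    rw [hℓ, mul_div_cancel₀ _ (rpow_pos_of_pos hy _).ne']
  have hexp : ∀ x : ℝ, 0 < x → x ^ ((α - m) / α) = (x ^ β)⁻¹ := by
    intro x hx
    rw [← rpow_neg hx.le, hβ, ← neg_div, neg_sub]
  have hβinv : Tendsto (fun x : ℝ => (x ^ β)⁻¹) atTop (𝓝 0) :=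
    (tendsto_rpow_atTop hβ0).inv_tendsto_atTop
  have hlower : ∀ δ : ℝ, 0 < δ → δ < 1 → ∀ᶠ x : ℝ in atTop,
      0 < (halfLineLaw f).real (Ioo 0 (1 / x)) ∧
      (1 + δ) ^ β * (1 - δ + ℓ ((1 + δ) * x)) - (x ^ β)⁻¹ * log 2 ≤
        (x ^ β)⁻¹ * log ((halfLineLaw f).real (Ioo 0 (1 / x))) := by
    intro δ hδ hδ1
    obtain ⟨C, hC⟩ := hf.le_measureReal_Ioo hα hm0 hδ hδ1
    have hy : Tendsto (fun x : ℝ => (1 + δ) * x) atTop atTop :=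
      tendsto_id.const_mul_atTop (by linarith)
    have hsmall := ((hβinv.comp hy).const_mul C).eventually_lt_const
      (show C * 0 < 1 / 2 by norm_num)
    filter_upwards [hsmall, eventually_gt_atTop 0] with x hx hx0
    have hy0 : 0 < (1 + δ) * x := by positivity
    have hCy := hC _ hy0
    have hL := hf.laplace_pos (rpow_nonneg hy0.le (m / α))
    rw [← inv_div ((_ * x) ^ (m / α)), hpβ _ hy0,
      show (1 + δ) / ((1 + δ) * x) = 1 / x by field_simp] at hCy
    have hF : exp (((1 + δ) * x) ^ β * (1 - δ)) * (laplace f (((1 + δ) * x) ^ (m / α)) * (1 / 2)) ≤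
        (halfLineLaw f).real (Ioo 0 (1 / x)) := by
      refine le_trans ?_ hCy
      simp only [Function.comp_apply] at hx
      gcongr
      linarith
    have hpos : 0 < exp (((1 + δ) * x) ^ β * (1 - δ)) *
      (laplace f (((1 + δ) * x) ^ (m / α)) * (1 / 2)) := by positivity
    refine ⟨hpos.trans_le hF, ?_⟩
    have hlog := log_le_log hpos hF
    rw [log_mul (exp_pos _).ne' (by positivity), log_mul hL.ne' (by norm_num), log_exp,
      hlogℓ _ hy0, one_div, log_inv, mul_rpow (by linarith) hx0.le] at hlog
    have hxβ : 0 < x ^ β := rpow_pos_of_pos hx0 _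
    calc (1 + δ) ^ β * (1 - δ + ℓ ((1 + δ) * x)) - (x ^ β)⁻¹ * log 2
        = (x ^ β)⁻¹ * ((1 + δ) ^ β * x ^ β * (1 - δ) +
            ((1 + δ) ^ β * x ^ β * ℓ ((1 + δ) * x) + -log 2)) := by
          field_simp
          ring
      _ ≤ _ := by gcongr
  have hupper : ∀ᶠ x : ℝ in atTop,
      (x ^ β)⁻¹ * log ((halfLineLaw f).real (Ioo 0 (1 / x))) ≤ 1 + ℓ x := by
    filter_upwards [hlower (1 / 2) (by norm_num) (by norm_num), eventually_gt_atTop 0]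
      with x hx hx0
    have hxβ : 0 < x ^ β := rpow_pos_of_pos hx0 _
    have hr0 : 0 ≤ x ^ (m / α) := rpow_nonneg hx0.le _
    have h := log_le_log hx.1 (hf.measureReal_Ioo_le (ε := 1 / x) hr0)
    rw [log_mul (exp_pos _).ne' (hf.laplace_pos hr0).ne', log_exp, hlogℓ x hx0, mul_one_div,
      hpβ x hx0] at h
    rw [inv_mul_le_iff₀ hxβ]
    linarith
  have hlimit : 1 + -(m / (m - α)) = -(α / (m - α)) := by
    have hma : m - α ≠ 0 := (sub_pos.2 hm).ne'
    field_simp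
    ring
  have hmain : Tendsto (fun x : ℝ => (x ^ β)⁻¹ * log ((halfLineLaw f).real (Ioo 0 (1 / x))))
      atTop (𝓝 (-(α / (m - α)))) := by
    rw [tendsto_order]
    constructor
    · intro l hl
      have hδlim : Tendsto (fun δ : ℝ => (1 + δ) ^ β * (1 - δ + -(m / (m - α)))) (𝓝[>] 0)
          (𝓝 (-(α / (m - α)))) := by
        have hc : ContinuousAt (fun δ : ℝ => (1 + δ) ^ β * (1 - δ + -(m / (m - α)))) 0 := by
          refine ContinuousAt.mul (ContinuousAt.rpow_const (by fun_prop) (Or.inl (by norm_num)))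
            (by fun_prop)
        have h := hc.tendsto
        simp only [add_zero, one_rpow, sub_zero, one_mul, hlimit] at h
        exact h.mono_left nhdsWithin_le_nhds
      obtain ⟨δ, hlδ, hδ⟩ := ((hδlim.eventually_const_lt hl).and
        (Ioo_mem_nhdsGT (show (0 : ℝ) < 1 by norm_num))).exists
      have hy : Tendsto (fun x : ℝ => (1 + δ) * x) atTop atTop :=
        tendsto_id.const_mul_atTop (by linarith [hδ.1])
      have hlim := (((hℓlim.comp hy).const_add (1 - δ)).const_mul ((1 + δ) ^ β)).sub
        (hβinv.mul_const (log 2))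
      rw [zero_mul, sub_zero] at hlim
      filter_upwards [hlim.eventually_const_lt hlδ, hlower δ hδ.1 hδ.2] with x h1 h2
      exact h1.trans_le h2.2
    · intro u hu
      have h := hℓlim.const_add 1
      rw [hlimit] at h
      filter_upwards [hupper, h.eventually_lt_const hu] with x h1 h2
      exact h1.trans_lt h2
  refine hmain.congr' ?_
  filter_upwards [eventually_gt_atTop 0] with x hx
  rw [hexp x hx, hf.setIntegral_eq]
end
end

section
/- Let α > 0, m > α, set b = (m−α)/α, and let f be the unique density solution to the equation x^m f(x) = (1/Γ(α)) ∫_0^x (x−v)^{α−1} f(v) dv on (0,∞). Then the sequence a_n = (1/n) · ( ∫_0^∞ t^{−bn} f(t) dt )^{1/n} converges to b/e as n → ∞ (e being Euler's number). -/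
open MeasureTheory Real Set Filter

noncomputable section

lemma lintegral_rpow_mul_exp_neg_mul_Ioi {a r : ℝ} (ha : 0 < a) (hr : 0 < r) :
    ∫⁻ t in Ioi (0:ℝ), ENNReal.ofReal (t ^ (a - 1) * Real.exp (-(r * t))) =
      ENNReal.ofReal ((1 / r) ^ a * Real.Gamma a) := by
  have h := Real.integral_rpow_mul_exp_neg_mul_Ioi ha hr
  have hpos : 0 < (1 / r) ^ a * Real.Gamma a :=
    mul_pos (Real.rpow_pos_of_pos (by positivity) _) (Real.Gamma_pos_of_pos ha)
  rw [← h, ofReal_integral_eq_lintegral_ofReal]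
  · by_contra hi
    rw [integral_undef hi] at h
    exact hpos.ne h
  · filter_upwards [ae_restrict_mem measurableSet_Ioi] with t ht
    have ht : 0 < t := ht
    simp only [Pi.zero_apply]
    positivity

lemma lintegral_Ioi_comp_sub (h : ℝ → ENNReal) (v : ℝ) :
    ∫⁻ x in Ioi v, h (x - v) = ∫⁻ u in Ioi (0:ℝ), h u := by
  rw [← lintegral_indicator measurableSet_Ioi, ← lintegral_indicator measurableSet_Ioi,
    ← lintegral_add_right_eq_self _ v]
  refine lintegral_congr fun x => ?_
  simp [Set.indicator_apply]

/-- The Laplace transform of the kernel `(x - v) ^ (α - 1)` on `(v, ∞)`. -/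
lemma lintegral_sub_rpow_mul_exp_Ioi {α y : ℝ} (hα : 0 < α) (hy : 0 < y) (v : ℝ) :
    ∫⁻ x in Ioi v, ENNReal.ofReal (Real.exp (-(y * x))) * ENNReal.ofReal ((x - v) ^ (α - 1)) =
      ENNReal.ofReal (Real.exp (-(y * v)) * ((1 / y) ^ α * Real.Gamma α)) := by
  rw [ENNReal.ofReal_mul (by positivity), ← lintegral_rpow_mul_exp_neg_mul_Ioi hα hy,
    ← lintegral_Ioi_comp_sub _ v, ← lintegral_const_mul _ (by fun_prop)]
  refine setLIntegral_congr_fun measurableSet_Ioi fun x hx => ?_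
  have hx : 0 < x - v := sub_pos.2 hx
  rw [← ENNReal.ofReal_mul (by positivity), ← ENNReal.ofReal_mul (by positivity)]
  congr 1
  rw [mul_left_comm, ← Real.exp_add, mul_comm]
  ring_nf

/-- The beta integral `∫_v^∞ x^{-p} (x - v)^{α - 1} dx`. -/
lemma lintegral_rpow_neg_mul_sub_rpow_Ioi {α p v : ℝ} (hα : 0 < α) (hp : α < p) (hv : 0 < v) :
    ENNReal.ofReal (Real.Gamma p) *
      ∫⁻ x in Ioi v, ENNReal.ofReal (x ^ (-p)) * ENNReal.ofReal ((x - v) ^ (α - 1)) =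
    ENNReal.ofReal (Real.Gamma α * Real.Gamma (p - α)) * ENNReal.ofReal (v ^ (-(p - α))) := by
  have hp0 : 0 < p := hα.trans hp
  have hpα : 0 < p - α := sub_pos.2 hp
  have hG : 0 < Real.Gamma α := Real.Gamma_pos_of_pos hα
  have hG' : 0 < Real.Gamma (p - α) := Real.Gamma_pos_of_pos hpα
  calc
    _ = ∫⁻ x in Ioi v, ∫⁻ y in Ioi (0:ℝ), ENNReal.ofReal (y ^ (p - 1)) *
          (ENNReal.ofReal (Real.exp (-(y * x))) * ENNReal.ofReal ((x - v) ^ (α - 1))) := by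
      rw [← lintegral_const_mul _ (by fun_prop)]
      refine setLIntegral_congr_fun measurableSet_Ioi fun x hx => ?_
      have hx0 : 0 < x := hv.trans hx
      have := lintegral_rpow_mul_exp_neg_mul_Ioi hp0 hx0
      rw [one_div, Real.inv_rpow hx0.le, ← Real.rpow_neg hx0.le, mul_comm,
        ENNReal.ofReal_mul (Real.Gamma_pos_of_pos hp0).le] at this
      rw [← mul_assoc, ← this, ← lintegral_mul_const _ (by fun_prop)]
      refine setLIntegral_congr_fun measurableSet_Ioi fun y hy => ?_
      have hy : 0 < y := hy
      rw [ENNReal.ofReal_mul (by positivity), mul_assoc, mul_comm x y]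
    _ = ∫⁻ y in Ioi (0:ℝ), ∫⁻ x in Ioi v, ENNReal.ofReal (y ^ (p - 1)) *
          (ENNReal.ofReal (Real.exp (-(y * x))) * ENNReal.ofReal ((x - v) ^ (α - 1))) :=
      lintegral_lintegral_swap (by unfold Function.uncurry; fun_prop)
    _ = ∫⁻ y in Ioi (0:ℝ), ENNReal.ofReal (Real.Gamma α) *
          ENNReal.ofReal (y ^ (p - α - 1) * Real.exp (-(v * y))) := by
      refine setLIntegral_congr_fun measurableSet_Ioi fun y hy => ?_
      have hy : 0 < y := hy
      rw [lintegral_const_mul _ (by fun_prop), lintegral_sub_rpow_mul_exp_Ioi hα hy,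
        ← ENNReal.ofReal_mul (by positivity), ← ENNReal.ofReal_mul (by positivity)]
      congr 1
      rw [one_div, Real.inv_rpow hy.le, ← Real.rpow_neg hy.le,
        show p - α - 1 = (p - 1) + -α by ring, Real.rpow_add hy, mul_comm v y]
      ring
    _ = _ := by
      rw [lintegral_const_mul _ (by fun_prop), lintegral_rpow_mul_exp_neg_mul_Ioi hpα hv,
        ← ENNReal.ofReal_mul (by positivity), ← ENNReal.ofReal_mul (by positivity)]
      congr 1
      rw [one_div, Real.inv_rpow hv.le, ← Real.rpow_neg hv.le]
      ring

lemma setLIntegral_Ioo_eq_indicator (h : ℝ → ENNReal) (x : ℝ) :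
    ∫⁻ v in Ioo 0 x, h v = ∫⁻ v in Ioi (0:ℝ), (Iio x).indicator h v := by
  rw [lintegral_indicator measurableSet_Iio, Measure.restrict_restrict measurableSet_Iio,
    inter_comm, Ioi_inter_Iio]

/-- Tonelli's theorem for the Riemann–Liouville integral of order `α`. -/
lemma lintegral_mul_riemannLiouville (α : ℝ) {w g : ℝ → ENNReal} (hw : Measurable w)
    (hg : Measurable g) :
    ∫⁻ x in Ioi (0:ℝ), w x * ∫⁻ v in Ioo 0 x, ENNReal.ofReal ((x - v) ^ (α - 1)) * g v =
      ∫⁻ v in Ioi (0:ℝ), g v * ∫⁻ x in Ioi v, w x * ENNReal.ofReal ((x - v) ^ (α - 1)) := by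
  have hm : Measurable fun q : ℝ × ℝ => {q : ℝ × ℝ | q.2 < q.1}.indicator
      (fun q => w q.1 * (ENNReal.ofReal ((q.1 - q.2) ^ (α - 1)) * g q.2)) q :=
    Measurable.indicator (by fun_prop) (measurableSet_lt measurable_snd measurable_fst)
  calc
    _ = ∫⁻ x in Ioi (0:ℝ), ∫⁻ v in Ioi (0:ℝ), {q : ℝ × ℝ | q.2 < q.1}.indicator
      (fun q => w q.1 * (ENNReal.ofReal ((q.1 - q.2) ^ (α - 1)) * g q.2)) (x, v) := by
      refine lintegral_congr fun x => ?_
      rw [← lintegral_const_mul _ (by fun_prop), setLIntegral_Ioo_eq_indicator]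
      rfl
    _ = ∫⁻ v in Ioi (0:ℝ), ∫⁻ x in Ioi (0:ℝ), {q : ℝ × ℝ | q.2 < q.1}.indicator
      (fun q => w q.1 * (ENNReal.ofReal ((q.1 - q.2) ^ (α - 1)) * g q.2)) (x, v) :=
      lintegral_lintegral_swap hm.aemeasurable
    _ = _ := by
      refine setLIntegral_congr_fun measurableSet_Ioi fun v hv => ?_
      have hv : 0 < v := hv
      rw [← lintegral_const_mul _ (by fun_prop)]
      have : Ioi v = Ioi v ∩ Ioi 0 := by
        rw [Ioi_inter_Ioi, sup_eq_left.2 hv.le]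
      rw [this, ← Measure.restrict_restrict measurableSet_Ioi,
        ← lintegral_indicator (μ := volume.restrict (Ioi 0)) measurableSet_Ioi]
      refine lintegral_congr fun x => ?_
      simp only [Set.indicator_apply, mem_ofPred_eq, mem_Ioi]
      split_ifs
      · ring
      · rfl

lemma IsDensitySolution.lintegral_eq_one {α m : ℝ} {f : ℝ → ℝ} (hf : IsDensitySolution α m f) :
    ∫⁻ x in Ioi (0:ℝ), ENNReal.ofReal (f x) = 1 := by
  obtain ⟨-, hnn, hint, -⟩ := hf
  rw [← ofReal_integral_eq_lintegral_ofReal, hint, ENNReal.ofReal_one]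
  · by_contra hi
    rw [integral_undef hi] at hint
    exact zero_ne_one hint
  · filter_upwards [ae_restrict_mem measurableSet_Ioi] with t ht using hnn t ht

lemma measurable_riemannLiouville (α : ℝ) {g : ℝ → ENNReal} (hg : Measurable g) :
    Measurable fun x : ℝ => ∫⁻ v in Ioo 0 x, ENNReal.ofReal ((x - v) ^ (α - 1)) * g v := by
  simp_rw [setLIntegral_Ioo_eq_indicator]
  have hm : Measurable fun q : ℝ × ℝ => {q : ℝ × ℝ | q.2 < q.1}.indicator
      (fun q => ENNReal.ofReal ((q.1 - q.2) ^ (α - 1)) * g q.2) q :=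
    Measurable.indicator (by fun_prop) (measurableSet_lt measurable_snd measurable_fst)
  exact hm.lintegral_prod_right'

/-- The fractional integral is finite almost everywhere, so the equation also holds for
extended nonnegative integrals at almost every point. -/
lemma IsDensitySolution.ae_eq {α m : ℝ} (hα : 0 < α) {f : ℝ → ℝ} (hf : IsDensitySolution α m f) :
    ∀ᵐ x ∂(volume.restrict (Ioi (0:ℝ))),
      ENNReal.ofReal (Real.Gamma α) * ENNReal.ofReal (x ^ m * f x) =
        ∫⁻ v in Ioo 0 x, ENNReal.ofReal ((x - v) ^ (α - 1)) * ENNReal.ofReal (f v) := by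
  have h1 := hf.lintegral_eq_one
  obtain ⟨hmeas, hnn, -, heq⟩ := hf
  have hg : Measurable fun x => ENNReal.ofReal (f x) := by fun_prop
  have hH := measurable_riemannLiouville α hg
  have hG := Real.Gamma_pos_of_pos hα
  have hfin : ∫⁻ x in Ioi (0:ℝ), ENNReal.ofReal (Real.exp (-(1 * x))) *
      ∫⁻ v in Ioo 0 x, ENNReal.ofReal ((x - v) ^ (α - 1)) * ENNReal.ofReal (f v) ≠ ⊤ := by
    rw [lintegral_mul_riemannLiouville α (by fun_prop) hg]
    refine ne_top_of_le_ne_top (b := 1 * ENNReal.ofReal (Real.Gamma α)) (by finiteness) ?_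
    rw [← h1, ← lintegral_mul_const _ hg]
    refine setLIntegral_mono (by fun_prop) fun v hv => ?_
    have hv : 0 < v := hv
    rw [lintegral_sub_rpow_mul_exp_Ioi hα one_pos]
    gcongr
    rw [div_one, Real.one_rpow, one_mul, one_mul]
    exact mul_le_of_le_one_left hG.le (Real.exp_le_one_iff.2 (by linarith))
  filter_upwards [ae_lt_top (by fun_prop) hfin, ae_restrict_mem measurableSet_Ioi] with x hx hx0
  have hx' : ∫⁻ v in Ioo 0 x, ENNReal.ofReal ((x - v) ^ (α - 1)) * ENNReal.ofReal (f v) ≠ ⊤ := by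
    intro htop
    rw [htop, ENNReal.mul_top] at hx
    · exact hx.ne rfl
    · simpa using Real.exp_pos _
  have hcongr : ∫⁻ v in Ioo 0 x, ENNReal.ofReal ((x - v) ^ (α - 1)) * ENNReal.ofReal (f v) =
      ∫⁻ v in Ioo 0 x, ENNReal.ofReal ((x - v) ^ (α - 1) * f v) := by
    refine setLIntegral_congr_fun measurableSet_Ioo fun v hv => ?_
    exact (ENNReal.ofReal_mul (Real.rpow_nonneg (sub_pos.2 hv.2).le _)).symm
  rw [← ENNReal.ofReal_mul hG.le, heq x hx0, ← mul_assoc, mul_one_div_cancel hG.ne', one_mul,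
    integral_eq_lintegral_of_nonneg_ae, ← hcongr, ENNReal.ofReal_toReal hx']
  · filter_upwards [ae_restrict_mem measurableSet_Ioo] with v hv
    exact mul_nonneg (Real.rpow_nonneg (sub_pos.2 hv.2).le _) (hnn v hv.1)
  · exact (by fun_prop : Measurable _).aestronglyMeasurable

/-- The recursion `Γ(s+m) 𝔼[X^{-s}] = Γ(s+m-α) 𝔼[X^{-(s+m-α)}]` for the negative moments. -/
lemma IsDensitySolution.moment_recursion {α m s : ℝ} (hα : 0 < α) (hs : α < s + m) {f : ℝ → ℝ}
    (hf : IsDensitySolution α m f) :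
    ENNReal.ofReal (Real.Gamma (s + m)) *
      ∫⁻ x in Ioi (0:ℝ), ENNReal.ofReal (x ^ (-s)) * ENNReal.ofReal (f x) =
    ENNReal.ofReal (Real.Gamma (s + m - α)) *
      ∫⁻ x in Ioi (0:ℝ), ENNReal.ofReal (x ^ (-(s + m - α))) * ENNReal.ofReal (f x) := by
  have hae := hf.ae_eq hα
  obtain ⟨hmeas, hnn, -, -⟩ := hf
  have hg : Measurable fun x => ENNReal.ofReal (f x) := by fun_prop
  have hG := Real.Gamma_pos_of_pos hα
  have hG0 : ENNReal.ofReal (Real.Gamma α) ≠ 0 := by simpa using hG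
  rw [← ENNReal.mul_right_inj hG0 ENNReal.ofReal_ne_top]
  calc
    _ = ENNReal.ofReal (Real.Gamma (s + m)) * ∫⁻ x in Ioi (0:ℝ), ENNReal.ofReal (x ^ (-(s + m))) *
        ∫⁻ v in Ioo 0 x, ENNReal.ofReal ((x - v) ^ (α - 1)) * ENNReal.ofReal (f v) := by
      rw [mul_left_comm, ← lintegral_const_mul _ (by fun_prop)]
      congr 1
      refine lintegral_congr_ae ?_
      filter_upwards [hae, ae_restrict_mem measurableSet_Ioi] with x hx hx0
      have hx0 : 0 < x := hx0
      have hpow : x ^ (-s) = x ^ (-(s + m)) * x ^ m := by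
        rw [← Real.rpow_add hx0]
        ring_nf
      rw [← hx, ENNReal.ofReal_mul (p := x ^ m) (by positivity), hpow,
        ENNReal.ofReal_mul (by positivity)]
      ring
    _ = ∫⁻ v in Ioi (0:ℝ), ENNReal.ofReal (Real.Gamma α * Real.Gamma (s + m - α)) *
          (ENNReal.ofReal (v ^ (-(s + m - α))) * ENNReal.ofReal (f v)) := by
      rw [lintegral_mul_riemannLiouville α (by fun_prop) hg, ← lintegral_const_mul']
      · refine setLIntegral_congr_fun measurableSet_Ioi fun v hv => ?_
        rw [mul_left_comm, lintegral_rpow_neg_mul_sub_rpow_Ioi hα hs hv]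
        ring
      · finiteness
    _ = _ := by
      rw [lintegral_const_mul _ (by fun_prop), ENNReal.ofReal_mul hG.le, mul_assoc]

/-- Bounds on ratios of values of the Gamma function, from its logarithmic convexity. -/
lemma log_Gamma_add_sub_log_Gamma_mem_Icc {α x : ℝ} (hα : 0 < α) (hx : 1 < x) :
    (Real.log (Real.Gamma (x + α)) - Real.log (Real.Gamma x)) / α ∈
      Icc (Real.log (x - 1)) (Real.log (x + α)) := by
  have hstep : ∀ y : ℝ, 0 < y →
      Real.log (Real.Gamma (y + 1)) - Real.log (Real.Gamma y) = Real.log y := fun y hy => by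
    rw [Real.Gamma_add_one hy.ne', Real.log_mul hy.ne' (Real.Gamma_pos_of_pos hy).ne']
    ring
  have h1 := Real.convexOn_log_Gamma.slope_mono_adjacent (x := x - 1) (y := x) (z := x + α)
    (sub_pos.2 hx) (by simp only [mem_Ioi]; linarith) (by linarith) (by linarith)
  have h2 := Real.convexOn_log_Gamma.slope_mono_adjacent (x := x) (y := x + α) (z := x + α + 1)
    (by simp only [mem_Ioi]; linarith) (by simp only [mem_Ioi]; linarith) (by linarith)
    (by linarith)
  have h3 := hstep (x - 1) (sub_pos.2 hx)
  have h4 := hstep (x + α) (by linarith)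
  simp only [Function.comp_apply, sub_sub_cancel, add_sub_cancel_left, div_one] at h1 h2
  rw [sub_add_cancel] at h3
  exact ⟨h3 ▸ h1, h4 ▸ h2⟩

lemma tendsto_log_Gamma_ratio_sub_log {α c : ℝ} (hα : 0 < α) (hc : 0 < c) :
    Tendsto (fun j : ℕ => (Real.log (Real.Gamma ((j + 1 : ℕ) * c + α)) -
        Real.log (Real.Gamma ((j + 1 : ℕ) * c))) / α - Real.log (j + 1 : ℕ)) atTop
      (nhds (Real.log c)) := by
  have hlim : ∀ d : ℝ, Tendsto (fun j : ℕ => Real.log (((j + 1 : ℕ) : ℝ) * c + d)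
      - Real.log (j + 1 : ℕ)) atTop (nhds (Real.log c)) := fun d => by
    have h1 : Tendsto (fun j : ℕ => c + d / ((j : ℝ) + 1)) atTop (nhds (c + 0)) :=
      tendsto_const_nhds.add (tendsto_const_nhds.div_atTop
        (tendsto_atTop_add_const_right _ _ tendsto_natCast_atTop_atTop))
    rw [add_zero] at h1
    refine (h1.log hc.ne').congr' ?_
    filter_upwards [h1.eventually (lt_mem_nhds hc)] with j hj
    have hj1 : (0 : ℝ) < (j : ℝ) + 1 := by positivity
    push_cast
    rw [show ((j : ℝ) + 1) * c + d = (j + 1) * (c + d / (j + 1)) by field_simp,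
      Real.log_mul hj1.ne' hj.ne']
    ring
  have hbig : ∀ᶠ j : ℕ in atTop, 1 < ((j + 1 : ℕ) : ℝ) * c := by
    have : Tendsto (fun j : ℕ => ((j + 1 : ℕ) : ℝ) * c) atTop atTop :=
      (tendsto_natCast_atTop_atTop.comp (tendsto_add_atTop_nat 1)).atTop_mul_const hc
    exact this.eventually_gt_atTop 1
  refine tendsto_of_tendsto_of_tendsto_of_le_of_le' (hlim (-1)) (hlim α) ?_ ?_
  · filter_upwards [hbig] with j hj
    have := (log_Gamma_add_sub_log_Gamma_mem_Icc hα hj).1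
    rw [← sub_eq_add_neg]
    linarith
  · filter_upwards [hbig] with j hj
    have := (log_Gamma_add_sub_log_Gamma_mem_Icc hα hj).2
    linarith

lemma tendsto_mul_log_succ_sub :
    Tendsto (fun j : ℕ => ((j + 1 : ℕ) : ℝ) * Real.log (j + 1 : ℕ) - j * Real.log j
      - Real.log (j + 1 : ℕ)) atTop (nhds 1) := by
  refine ((Real.tendsto_mul_log_one_add_div_atTop 1).comp tendsto_natCast_atTop_atTop).congr' ?_
  filter_upwards [eventually_gt_atTop 0] with j hj
  have hj : (0 : ℝ) < j := by exact_mod_cast hj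
  simp only [Function.comp_apply]
  push_cast
  rw [show 1 + 1 / (j : ℝ) = (j + 1) / j by field_simp, Real.log_div (by positivity) hj.ne']
  ring

/-- A product of Gamma ratios along an arithmetic progression grows like `(c k / e) ^ (α k)`. -/
lemma tendsto_of_log_Gamma_ratio {α c : ℝ} (hα : 0 < α) (hc : 0 < c) {L : ℕ → ℝ} (h0 : L 0 = 0)
    (hL : ∀ j : ℕ, L (j + 1) = L j + (Real.log (Real.Gamma ((j + 1 : ℕ) * c + α)) -
        Real.log (Real.Gamma ((j + 1 : ℕ) * c)))) :
    Tendsto (fun k : ℕ => L k / (k * α) - Real.log k) atTop (nhds (Real.log c - 1)) := by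
  have h := ((tendsto_log_Gamma_ratio_sub_log hα hc).sub tendsto_mul_log_succ_sub).cesaro
  refine h.congr' ?_
  filter_upwards [eventually_gt_atTop 0] with k hk
  have hsum : ∀ j : ℕ, (Real.log (Real.Gamma ((j + 1 : ℕ) * c + α)) -
        Real.log (Real.Gamma ((j + 1 : ℕ) * c))) / α - Real.log (j + 1 : ℕ) -
        (((j + 1 : ℕ) : ℝ) * Real.log (j + 1 : ℕ) - j * Real.log j - Real.log (j + 1 : ℕ)) =
      (L (j + 1) / α - (j + 1 : ℕ) * Real.log (j + 1 : ℕ)) - (L j / α - j * Real.log j) :=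
    fun j => by
      rw [hL]
      ring
  simp_rw [hsum]
  rw [Finset.sum_range_sub (fun j : ℕ => L j / α - j * Real.log j), h0]
  have hk : (0 : ℝ) < k := by exact_mod_cast hk
  field_simp
  simp

/-- The negative moment `∫_0^∞ x^{-s} f(x) dx` as an extended nonnegative number. -/
def negMoment (f : ℝ → ℝ) (s : ℝ) : ENNReal :=
  ∫⁻ x in Ioi (0:ℝ), ENNReal.ofReal (x ^ (-s)) * ENNReal.ofReal (f x)

/-- Lyapunov's inequality for the negative moments. -/
lemma IsDensitySolution.negMoment_rpow_le {α m p q : ℝ} {f : ℝ → ℝ} (hf : IsDensitySolution α m f)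
    (hp : 0 < p) (hpq : p ≤ q) : negMoment f p ^ (1 / p) ≤ negMoment f q ^ (1 / q) := by
  have h1 := hf.lintegral_eq_one
  have hmeas := hf.1
  have hg : Measurable fun x => ENNReal.ofReal (f x) := by fun_prop
  set μ := (volume.restrict (Ioi (0:ℝ))).withDensity fun x => ENNReal.ofReal (f x) with hμ
  have : IsProbabilityMeasure μ := ⟨by
    rw [hμ, withDensity_apply _ MeasurableSet.univ, Measure.restrict_univ, h1]⟩
  have hM : ∀ s, eLpNorm' (fun x : ℝ => x⁻¹) s μ = negMoment f s ^ (1 / s) := fun s => by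
    rw [eLpNorm', hμ, lintegral_withDensity_eq_lintegral_mul _ hg (by fun_prop), negMoment]
    congr 1
    refine setLIntegral_congr_fun measurableSet_Ioi fun x hx => ?_
    have hx : 0 < x := hx
    rw [Pi.mul_apply, mul_comm, Real.enorm_of_nonneg (by positivity),
      ENNReal.ofReal_rpow_of_pos (by positivity), Real.inv_rpow hx.le, Real.rpow_neg hx.le]
  rw [← hM, ← hM]
  exact eLpNorm'_le_eLpNorm'_of_exponent_le hp hpq μ
    (by fun_prop : Measurable fun x : ℝ => x⁻¹).aestronglyMeasurable

lemma IsDensitySolution.negMoment_ne_top {α m p q : ℝ} {f : ℝ → ℝ} (hf : IsDensitySolution α m f)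
    (hp : 0 < p) (hpq : p ≤ q) (hq : negMoment f q ≠ ⊤) : negMoment f p ≠ ⊤ := by
  intro h
  have := hf.negMoment_rpow_le hp hpq
  rw [h, ENNReal.top_rpow_of_pos (by positivity), top_le_iff, ENNReal.rpow_eq_top_iff_of_pos
    (one_div_pos.2 (hp.trans_le hpq))] at this
  exact hq this

lemma IsDensitySolution.negMoment_ne_zero {α m p q : ℝ} {f : ℝ → ℝ} (hf : IsDensitySolution α m f)
    (hp : 0 < p) (hpq : p ≤ q) (h0 : negMoment f p ≠ 0) : negMoment f q ≠ 0 := by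
  intro h
  have := hf.negMoment_rpow_le hp hpq
  rw [h, ENNReal.zero_rpow_of_pos (one_div_pos.2 (hp.trans_le hpq)), nonpos_iff_eq_zero,
    ENNReal.rpow_eq_zero_iff_of_pos (one_div_pos.2 hp)] at this
  exact h0 this

lemma IsDensitySolution.log_negMoment_div_le {α m p q : ℝ} {f : ℝ → ℝ}
    (hf : IsDensitySolution α m f) (hp : 0 < p) (hpq : p ≤ q) (h0 : negMoment f p ≠ 0)
    (hq : negMoment f q ≠ ⊤) :
    Real.log (negMoment f p).toReal / p ≤ Real.log (negMoment f q).toReal / q := by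
  have hp0 := ENNReal.toReal_pos h0 (hf.negMoment_ne_top hp hpq hq)
  have hq0 := ENNReal.toReal_pos (hf.negMoment_ne_zero hp hpq h0) hq
  have h := ENNReal.toReal_mono
    (ENNReal.rpow_ne_top_of_nonneg (one_div_pos.2 (hp.trans_le hpq)).le hq)
    (hf.negMoment_rpow_le hp hpq)
  rw [← ENNReal.toReal_rpow, ← ENNReal.toReal_rpow] at h
  have h' := Real.log_le_log (Real.rpow_pos_of_pos hp0 _) h
  rw [Real.log_rpow hp0, Real.log_rpow hq0] at h'
  simpa only [one_div, div_eq_inv_mul, mul_one] using h'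

lemma IsDensitySolution.negMoment_zero {α m : ℝ} {f : ℝ → ℝ} (hf : IsDensitySolution α m f) :
    negMoment f 0 = 1 := by
  simp [negMoment, hf.lintegral_eq_one]

lemma IsDensitySolution.negMoment_succ_mul {α m : ℝ} {f : ℝ → ℝ} (hf : IsDensitySolution α m f)
    (hα : 0 < α) (hm : α < m) (j : ℕ) :
    ENNReal.ofReal (Real.Gamma ((j + 1 : ℕ) * (m - α) + α)) * negMoment f (j * (m - α)) =
      ENNReal.ofReal (Real.Gamma ((j + 1 : ℕ) * (m - α))) *
        negMoment f ((j + 1 : ℕ) * (m - α)) := by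
  have hj : 0 ≤ (j : ℝ) * (m - α) := mul_nonneg j.cast_nonneg (sub_pos.2 hm).le
  have h := hf.moment_recursion (s := j * (m - α)) hα (by linarith)
  have e : (j : ℝ) * (m - α) + m = (j + 1 : ℕ) * (m - α) + α := by push_cast; ring
  rw [e, add_sub_cancel_right] at h
  exact h

lemma IsDensitySolution.negMoment_natCast_mul {α m : ℝ} {f : ℝ → ℝ}
    (hf : IsDensitySolution α m f) (hα : 0 < α) (hm : α < m) (j : ℕ) :
    negMoment f (j * (m - α)) ≠ 0 ∧ negMoment f (j * (m - α)) ≠ ⊤ := by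
  induction j with
  | zero => simp [hf.negMoment_zero]
  | succ j ih =>
    have h := hf.negMoment_succ_mul hα hm j
    have hc : 0 < ((j + 1 : ℕ) : ℝ) * (m - α) := mul_pos (by positivity) (sub_pos.2 hm)
    have h1 := Real.Gamma_pos_of_pos hc
    have h2 := Real.Gamma_pos_of_pos (add_pos hc hα)
    constructor <;> intro hz <;> rw [hz] at h
    · rw [mul_zero, mul_eq_zero, ENNReal.ofReal_eq_zero] at h
      exact h.elim (fun h => h2.not_ge h) ih.1
    · rw [ENNReal.mul_top (by simpa using h1)] at h
      exact ENNReal.mul_ne_top ENNReal.ofReal_ne_top ih.2 h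

lemma IsDensitySolution.tendsto_log_negMoment {α m : ℝ} {f : ℝ → ℝ}
    (hf : IsDensitySolution α m f) (hα : 0 < α) (hm : α < m) :
    Tendsto (fun k : ℕ => Real.log (negMoment f (k * (m - α))).toReal / (k * α) - Real.log k)
      atTop (nhds (Real.log (m - α) - 1)) := by
  refine tendsto_of_log_Gamma_ratio hα (sub_pos.2 hm)
    (L := fun k : ℕ => Real.log (negMoment f (k * (m - α))).toReal)
    (by simp [hf.negMoment_zero]) fun j => ?_
  have hpos : ∀ i : ℕ, 0 < (negMoment f (i * (m - α))).toReal := fun i =>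
    ENNReal.toReal_pos (hf.negMoment_natCast_mul hα hm i).1 (hf.negMoment_natCast_mul hα hm i).2
  have hc : 0 < ((j + 1 : ℕ) : ℝ) * (m - α) := mul_pos (by positivity) (sub_pos.2 hm)
  have h1 := Real.Gamma_pos_of_pos hc
  have h2 := Real.Gamma_pos_of_pos (add_pos hc hα)
  have h := congrArg (fun z => Real.log z.toReal) (hf.negMoment_succ_mul hα hm j)
  simp only [ENNReal.toReal_mul, ENNReal.toReal_ofReal h1.le, ENNReal.toReal_ofReal h2.le] at h
  rw [Real.log_mul h1.ne' (hpos _).ne', Real.log_mul h2.ne' (hpos _).ne'] at h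
  linarith

lemma IsDensitySolution.integral_eq_toReal_negMoment {α m : ℝ} {f : ℝ → ℝ}
    (hf : IsDensitySolution α m f) (s : ℝ) :
    ∫ t in Ioi (0:ℝ), t ^ (-s) * f t = (negMoment f s).toReal := by
  obtain ⟨hmeas, hnn, -, -⟩ := hf
  rw [integral_eq_lintegral_of_nonneg_ae, negMoment]
  · congr 1
    refine setLIntegral_congr_fun measurableSet_Ioi fun x hx => ?_
    exact ENNReal.ofReal_mul (Real.rpow_nonneg (le_of_lt hx) _)
  · filter_upwards [ae_restrict_mem measurableSet_Ioi] with x hx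
    exact mul_nonneg (Real.rpow_nonneg (le_of_lt hx) _) (hnn x hx)
  · exact (by fun_prop : Measurable _).aestronglyMeasurable

/-- With `b = (m−α)/α`, the sequence `a_n = (1/n) (∫_0^∞ t^{−bn} f(t) dt)^{1/n}`
converges to `b/e`. -/
theorem density_solution_moment_growth (α m : ℝ) (hα : 0 < α) (hm : α < m)
    (b : ℝ) (hb : b = (m - α) / α)
    (f : ℝ → ℝ) (hf : IsDensitySolution α m f) :
    Filter.Tendsto
      (fun n : ℕ =>
        (1 / (n : ℝ)) * (∫ t in Set.Ioi (0:ℝ), t ^ (-(b * n)) * f t) ^ ((n : ℝ)⁻¹))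
      Filter.atTop (nhds (b / Real.exp 1)) := by
  have hc : 0 < m - α := sub_pos.2 hm
  have hb0 : 0 < b := hb ▸ div_pos hc hα
  have hbα : m - α = b * α := by rw [hb]; field_simp
  have hk : Tendsto (fun n : ℕ => ⌊α⁻¹ * (n : ℝ)⌋₊) atTop atTop :=
    tendsto_nat_floor_atTop.comp
      (tendsto_natCast_atTop_atTop.const_mul_atTop (inv_pos.2 hα))
  have hratio : Tendsto (fun n : ℕ => (⌊α⁻¹ * (n : ℝ)⌋₊ : ℝ) / n) atTop (nhds α⁻¹) :=
    (tendsto_nat_floor_mul_div_atTop (inv_pos.2 hα).le).comp tendsto_natCast_atTop_atTop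
  have hratio' : Tendsto (fun n : ℕ => ((⌊α⁻¹ * (n : ℝ)⌋₊ + 1 : ℕ) : ℝ) / n) atTop
      (nhds α⁻¹) := by
    have := hratio.add (tendsto_one_div_atTop_nhds_zero_nat (𝕜 := ℝ))
    rw [add_zero] at this
    refine this.congr fun n => ?_
    push_cast
    ring
  have hG := hf.tendsto_log_negMoment hα hm
  have hlo := (hG.comp hk).add (hratio.log (inv_pos.2 hα).ne')
  have hhi := (hG.comp ((tendsto_add_atTop_nat 1).comp hk)).add
    (hratio'.log (inv_pos.2 hα).ne')
  have hscale : ∀ (k : ℕ) (n : ℝ), 0 < k → 0 < n →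
      Real.log (negMoment f (k * (m - α))).toReal / (k * α) - Real.log k + Real.log (k / n) =
        b * (Real.log (negMoment f (k * (m - α))).toReal / (k * (m - α))) - Real.log n :=
    fun k n hk hn => by
      have hk : (0 : ℝ) < k := by exact_mod_cast hk
      rw [Real.log_div hk.ne' hn.ne']
      have : ∀ y : ℝ, b * (y / (k * (m - α))) = y / (k * α) := fun y => by
        rw [hbα]; field_simp
      rw [this]
      ring
  have hfacts : ∀ᶠ n : ℕ in atTop, 0 < (n : ℝ) ∧ 0 < ⌊α⁻¹ * (n : ℝ)⌋₊ ∧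
      (⌊α⁻¹ * (n : ℝ)⌋₊ : ℝ) * (m - α) ≤ b * n ∧
      b * n ≤ (⌊α⁻¹ * (n : ℝ)⌋₊ + 1 : ℕ) * (m - α) := by
    filter_upwards [eventually_gt_atTop 0, hk.eventually_gt_atTop 0] with n hn hkn
    have hn : (0 : ℝ) < n := by exact_mod_cast hn
    have e : b * n = (α⁻¹ * n) * (m - α) := by rw [hbα]; field_simp
    rw [e]
    refine ⟨hn, hkn, ?_, ?_⟩
    · exact mul_le_mul_of_nonneg_right (Nat.floor_le (by positivity)) hc.le
    · push_cast
      exact mul_le_mul_of_nonneg_right (Nat.lt_floor_add_one _).le hc.le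
  have hdiv : ∀ n : ℝ, 0 < n → ∀ y : ℝ, b * (y / (b * n)) = y / n := fun n hn y => by
    field_simp
  have hlog : Tendsto (fun n : ℕ => Real.log (negMoment f (b * n)).toReal / n - Real.log n) atTop
      (nhds (Real.log (m - α) - 1 + Real.log α⁻¹)) := by
    refine tendsto_of_tendsto_of_tendsto_of_le_of_le' hlo hhi ?_ ?_
    · filter_upwards [hfacts] with n ⟨hn, hkn, h1, h2⟩
      have hkc : 0 < (⌊α⁻¹ * (n : ℝ)⌋₊ : ℝ) * (m - α) := mul_pos (by exact_mod_cast hkn) hc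
      simp only [Function.comp_apply]
      rw [hscale _ _ hkn hn, ← hdiv n hn]
      refine sub_le_sub_right (mul_le_mul_of_nonneg_left ?_ hb0.le) _
      exact hf.log_negMoment_div_le hkc h1 (hf.negMoment_natCast_mul hα hm _).1
        (hf.negMoment_ne_top (by positivity) h2 (hf.negMoment_natCast_mul hα hm _).2)
    · filter_upwards [hfacts] with n ⟨hn, hkn, h1, h2⟩
      have hkc : 0 < (⌊α⁻¹ * (n : ℝ)⌋₊ : ℝ) * (m - α) := mul_pos (by exact_mod_cast hkn) hc
      simp only [Function.comp_apply]
      rw [hscale _ _ (Nat.succ_pos _) hn, ← hdiv n hn]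
      refine sub_le_sub_right (mul_le_mul_of_nonneg_left ?_ hb0.le) _
      exact hf.log_negMoment_div_le (by positivity) h2
        (hf.negMoment_ne_zero hkc h1 (hf.negMoment_natCast_mul hα hm _).1)
        (hf.negMoment_natCast_mul hα hm _).2
  have hlim : Real.exp (Real.log (m - α) - 1 + Real.log α⁻¹) = b / Real.exp 1 := by
    rw [Real.exp_add, Real.exp_sub, Real.exp_log hc, Real.exp_log (inv_pos.2 hα), hb]
    ring
  rw [← hlim]
  refine ((Real.continuous_exp.tendsto _).comp hlog).congr' ?_
  filter_upwards [hfacts] with n ⟨hn, hkn, h1, h2⟩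
  have hkc : 0 < (⌊α⁻¹ * (n : ℝ)⌋₊ : ℝ) * (m - α) := mul_pos (by exact_mod_cast hkn) hc
  have hpos : 0 < (negMoment f (b * n)).toReal := ENNReal.toReal_pos
    (hf.negMoment_ne_zero hkc h1 (hf.negMoment_natCast_mul hα hm _).1)
    (hf.negMoment_ne_top (by positivity) h2 (hf.negMoment_natCast_mul hα hm _).2)
  rw [hf.integral_eq_toReal_negMoment, Function.comp_apply, Real.exp_sub, Real.exp_log hn,
    Real.rpow_def_of_pos hpos]
  simp only [div_eq_mul_inv]
  ring
end
end
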